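/- arXiv:1806.03475 — 2 statements merged into one kernel-verified Lean document; each statement's English description precedes it below -/
import Mathlib

section
/- Let A be an n×n real matrix with p distinct (complex) eigenvalues λ_1,…,λ_p, where λ_i has geometric multiplicity k_i and left eigenbasis X_i, and let B̄ ⊆ {1,…,n}×{1,…,l} be a sparsity pattern. Then there exists a real n×l matrix B conforming to B̄ such that (A,B) is controllable if and only if for every i ∈ {1,…,p} there exist a row index set J ∈ H_i, a column index set φ ⊆ {1,…,l} with |φ| = k_i, and a real k_i×k_i matrix C with nonzero determinant whose (s,t) entry is zero whenever (j_s, c_t) ∉ B̄, where j_1,…,j_{k_i} enumerate J and c_1,…,c_{k_i} enumerate φ (i.e., the k_i×k_i sub-pattern of B̄ with rows J and columns φ has generic rank k_i). -/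
open Matrix

noncomputable section

/-- The controllability matrix `[B, AB, A²B, …, A^{n-1}B]`, as an `n × (n·l)` matrix. -/
def ctrbMat {R : Type} [CommRing R] {n l : ℕ} (A : Matrix (Fin n) (Fin n) R)
    (B : Matrix (Fin n) (Fin l) R) : Matrix (Fin n) (Fin n × Fin l) R :=
  Matrix.of fun i jk => (A ^ (jk.1 : ℕ) * B) i jk.2

/-- `(A, B)` is controllable iff the controllability matrix has rank `n`. -/
def Controllable {R : Type} [CommRing R] {n l : ℕ} (A : Matrix (Fin n) (Fin n) R)
    (B : Matrix (Fin n) (Fin l) R) : Prop :=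
  (ctrbMat A B).rank = n

/-- The columns of a matrix, as vectors. -/
def matCols {R : Type} [CommRing R] {n k : ℕ} (X : Matrix (Fin n) (Fin k) R) :
    Fin k → (Fin n → R) := fun j i => X i j

/-- `X` is an `n × k` matrix whose columns are a basis of the λ-eigenspace of `Aᵀ`
(equivalently, its columns are `k` linearly independent left eigenvectors of `A`
for `μ`, spanning the whole left eigenspace; in particular `k` is the geometric
multiplicity of `μ`). -/
def IsLeftEigenbasis {n k : ℕ} (A : Matrix (Fin n) (Fin n) ℂ) (μ : ℂ)
    (X : Matrix (Fin n) (Fin k) ℂ) : Prop :=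
  LinearIndependent ℂ (matCols X) ∧
  (∀ j, A.transpose.mulVec (matCols X j) = μ • matCols X j) ∧
  (∀ v : Fin n → ℂ, A.transpose.mulVec v = μ • v →
      v ∈ Submodule.span ℂ (Set.range (matCols X)))

/-- The submatrix of `M` consisting of the columns indexed by `S`. -/
def colSub {R : Type} [CommRing R] {m n : ℕ} (M : Matrix (Fin m) (Fin n) R)
    (S : Finset (Fin n)) : Matrix (Fin m) {x // x ∈ S} R :=
  M.submatrix id (fun j => (j : Fin n))

/-- `H = {J ⊆ {1,…,n} : |J| = k and the k×k submatrix of Xᵀ formed by the columns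
indexed by J is invertible}` (invertibility of the square submatrix is expressed
as full rank `k`). -/
def Hset {n k : ℕ} (X : Matrix (Fin n) (Fin k) ℂ) : Set (Finset (Fin n)) :=
  {J | J.card = k ∧ (colSub X.transpose J).rank = k}

/-- The diagonal 0/1 matrix `I_S` selecting the states in `S`. -/
def diagSel {n : ℕ} (S : Finset (Fin n)) : Matrix (Fin n) (Fin n) ℝ :=
  Matrix.diagonal (fun j => if j ∈ S then (1 : ℝ) else 0)

/-- `‖B‖₀`, the number of nonzero entries of `B`. -/
def sparsity {n l : ℕ} (B : Matrix (Fin n) (Fin l) ℝ) : ℕ :=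
  (Finset.univ.filter fun jc : Fin n × Fin l => B jc.1 jc.2 ≠ 0).card

/-- The MACP optimum: the minimal cardinality of a set `S` of actuated states
such that `(A, I_S)` is controllable. -/
def MACPopt {n : ℕ} (A : Matrix (Fin n) (Fin n) ℝ) : ℕ :=
  sInf {m | ∃ S : Finset (Fin n), Controllable A (diagSel S) ∧ S.card = m}

/-- The `l`-MSCP optimum: the minimal number of nonzero entries of an `n × l`
real matrix `B` such that `(A, B)` is controllable. -/
def MSCPopt {n : ℕ} (A : Matrix (Fin n) (Fin n) ℝ) (l : ℕ) : ℕ :=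
  sInf {m | ∃ B : Matrix (Fin n) (Fin l) ℝ, Controllable A B ∧ sparsity B = m}

/-- Over a field, a matrix has full row rank iff its left kernel is trivial. -/
lemma rank_eq_card_iff_vecMul {K m n : Type*} [Field K] [Fintype m] [Fintype n]
    (M : Matrix m n K) :
    M.rank = Fintype.card m ↔ ∀ v : m → K, v ᵥ* M = 0 → v = 0 := by
  rw [M.rank_eq_finrank_span_row, eq_comm, ← Set.finrank,
    ← linearIndependent_iff_card_eq_finrank_span, ← vecMul_injective_iff,
    ← coe_vecMulLinear, injective_iff_map_eq_zero]
  rfl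

/-- If `det (M * N) ≠ 0`, then some choice of rows `g` makes the corresponding term of the
expansion of the determinant nonzero. -/
lemma exists_ne_zero_of_det_mul_ne_zero {K m n : Type*} [Field K] [Fintype m] [DecidableEq m]
    [Fintype n] (M : Matrix m n K) (N : Matrix n m K) (h : (M * N).det ≠ 0) :
    ∃ g : m → n, (∀ i, M i (g i) ≠ 0) ∧ (N.submatrix g id).det ≠ 0 := by
  have key : (M * N).det = ∑ g : m → n, (∏ i, M i (g i)) * (N.submatrix g id).det := by
    have h1 : M * N = fun i => ∑ j, M i j • N j := by
      ext i c
      simp [Matrix.mul_apply]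
    rw [h1]
    refine ((detRowAlternating : (m → K) [⋀^m]→ₗ[K] K).toMultilinearMap.map_sum
      (fun i j => M i j • N j)).trans (Finset.sum_congr rfl fun g _ => ?_)
    exact (detRowAlternating : (m → K) [⋀^m]→ₗ[K] K).toMultilinearMap.map_smul_univ _ _
  rw [key] at h
  obtain ⟨g, -, hg⟩ := Finset.exists_ne_zero_of_sum_ne_zero h
  exact ⟨g, fun i => Finset.prod_ne_zero_iff.1 (left_ne_zero_of_mul hg) i (Finset.mem_univ i),
    right_ne_zero_of_mul hg⟩

lemma injective_of_det_submatrix_ne_zero {K m n : Type*} [Field K] [Fintype m] [DecidableEq m]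
    {N : Matrix n m K} {g : m → n} (h : (N.submatrix g id).det ≠ 0) : Function.Injective g := by
  intro a b hab
  by_contra hne
  exact h (det_zero_of_row_eq hne (by ext c; simp [hab]))

/-- A matrix with trivial left kernel has a nonzero maximal minor. -/
lemma exists_det_submatrix_ne_zero {K m n : Type*} [Field K] [Fintype m] [DecidableEq m]
    [Fintype n] (M : Matrix m n K) (h : ∀ v : m → K, v ᵥ* M = 0 → v = 0) :
    ∃ f : m → n, Function.Injective f ∧ (M.submatrix id f).det ≠ 0 := by
  classical
  have hinj : Function.Injective Mᵀ.mulVecLin := by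
    rw [injective_iff_map_eq_zero]
    intro v hv
    exact h v (by simpa [mulVec_transpose] using hv)
  obtain ⟨g, hg⟩ := Mᵀ.mulVecLin.exists_leftInverse_of_injective (LinearMap.ker_eq_bot.2 hinj)
  have hD : LinearMap.toMatrix' g * Mᵀ = 1 := by
    rw [← LinearMap.toMatrix'_id, ← hg, LinearMap.toMatrix'_comp, ← Matrix.toLin'_apply',
      LinearMap.toMatrix'_toLin']
  obtain ⟨f, -, hf⟩ := exists_ne_zero_of_det_mul_ne_zero (LinearMap.toMatrix' g) Mᵀ
    (by simp [hD])
  refine ⟨f, injective_of_det_submatrix_ne_zero hf, ?_⟩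
  rwa [← det_transpose]

lemma vecMul_pow_mul {R m l : Type*} [CommRing R] [Fintype m] [DecidableEq m]
    {A : Matrix m m R} {B : Matrix m l R} {c : R} {u : m → R} (hA : u ᵥ* A = c • u)
    (hB : u ᵥ* B = 0) (j : ℕ) : u ᵥ* (A ^ j * B) = 0 := by
  induction j with
  | zero => simpa using hB
  | succ j ih => rw [pow_succ', Matrix.mul_assoc, ← vecMul_vecMul, hA, smul_vecMul, ih, smul_zero]

lemma controllable_iff_vecMul_pow {n l : ℕ} (A : Matrix (Fin n) (Fin n) ℝ)
    (B : Matrix (Fin n) (Fin l) ℝ) :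
    Controllable A B ↔ ∀ w : Fin n → ℝ, (∀ j : ℕ, w ᵥ* (A ^ j * B) = 0) → w = 0 := by
  have h := rank_eq_card_iff_vecMul (ctrbMat A B)
  rw [Fintype.card_fin] at h
  rw [Controllable, h]
  refine forall_congr' fun w => imp_congr_left ⟨fun hw j => ?_, fun hw => ?_⟩
  · have hlt : ∀ i < n, w ᵥ* (A ^ i * B) = 0 := fun i hi => by
      ext c
      exact congrFun hw (⟨i, hi⟩, c)
    rcases Nat.eq_zero_or_pos n with rfl | hn
    · ext c
      simp [vecMul, dotProduct]
    have hdeg : (Polynomial.X ^ j %ₘ A.charpoly).natDegree < n := by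
      have h1 := Polynomial.natDegree_modByMonic_lt (Polynomial.X ^ j) A.charpoly_monic
        (fun h1 => by
          have := A.charpoly_natDegree_eq_dim
          rw [h1, Polynomial.natDegree_one, Fintype.card_fin] at this
          omega)
      rwa [A.charpoly_natDegree_eq_dim, Fintype.card_fin] at h1
    rw [pow_eq_aeval_mod_charpoly, Polynomial.aeval_eq_sum_range' hdeg, Matrix.sum_mul,
      vecMul_sum]
    refine Finset.sum_eq_zero fun i hi => ?_
    rw [Matrix.smul_mul, vecMul_smul, hlt i (Finset.mem_range.1 hi), smul_zero]
  · ext ⟨i, c⟩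
    exact congrFun (hw i) c

/-- The Popov–Belevitch–Hautus eigenvector test. -/
lemma controllable_iff_forall_left_eigenvector {n l : ℕ} (A : Matrix (Fin n) (Fin n) ℝ)
    (B : Matrix (Fin n) (Fin l) ℝ) :
    Controllable A B ↔ ∀ (c : ℂ) (u : Fin n → ℂ), u ᵥ* A.map Complex.ofReal = c • u →
      u ᵥ* B.map Complex.ofReal = 0 → u = 0 := by
  have hmap : ∀ j : ℕ, A.map Complex.ofReal ^ j * B.map Complex.ofReal =
      (A ^ j * B).map Complex.ofReal := fun j => by
    have h1 : (A ^ j).map Complex.ofReal = A.map Complex.ofReal ^ j :=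
      Matrix.map_pow A Complex.ofRealHom j
    rw [← h1]
    exact (Matrix.map_mul (f := Complex.ofRealHom)).symm
  rw [controllable_iff_vecMul_pow]
  constructor
  · intro h c u hA hB
    have hu : ∀ j, u ᵥ* (A ^ j * B).map Complex.ofReal = 0 := fun j => by
      rw [← hmap]
      exact vecMul_pow_mul hA hB j
    have hre : (fun i => (u i).re) = 0 := h _ fun j => by
      ext t
      have := congrArg Complex.re (congrFun (hu j) t)
      simpa [vecMul, dotProduct] using this
    have him : (fun i => (u i).im) = 0 := h _ fun j => by
      ext t
      have := congrArg Complex.im (congrFun (hu j) t)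
      simpa [vecMul, dotProduct] using this
    ext i
    exact Complex.ext (congrFun hre i) (congrFun him i)
  · intro h w hw
    by_contra hne
    let W : Submodule ℂ (Fin n → ℂ) :=
      ⨅ j : ℕ, LinearMap.ker (A.map Complex.ofReal ^ j * B.map Complex.ofReal).vecMulLinear
    have memW : ∀ u, u ∈ W ↔
        ∀ j : ℕ, u ᵥ* (A.map Complex.ofReal ^ j * B.map Complex.ofReal) = 0 := fun u => by
      simp [W, Submodule.mem_iInf]
    have hinv : ∀ u ∈ W, (A.map Complex.ofReal).vecMulLinear u ∈ W := fun u hu => by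
      rw [memW] at hu ⊢
      intro j
      rw [vecMulLinear_apply, vecMul_vecMul, ← Matrix.mul_assoc, ← pow_succ']
      exact hu (j + 1)
    have hwW : (fun i => (w i : ℂ)) ∈ W := by
      rw [memW]
      intro j
      rw [hmap]
      ext t
      have := congrArg Complex.ofReal (congrFun (hw j) t)
      simpa [vecMul, dotProduct] using this
    have : Nontrivial W := by
      refine ⟨⟨⟨_, hwW⟩, 0, fun h0 => hne ?_⟩⟩
      ext i
      exact Complex.ofReal_eq_zero.1 (congrFun (congrArg Subtype.val h0) i)
    obtain ⟨c, hc⟩ := Module.End.exists_eigenvalue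
      ((A.map Complex.ofReal).vecMulLinear.restrict hinv)
    obtain ⟨u, hu⟩ := hc.exists_hasEigenvector
    refine hu.2 (Subtype.ext (h c u (congrArg Subtype.val hu.apply_eq_smul) ?_))
    simpa using (memW u).1 u.2 0

lemma mem_spectrum_of_vecMul_eq_smul {n : ℕ} {A : Matrix (Fin n) (Fin n) ℂ} {c : ℂ}
    {u : Fin n → ℂ} (hu : u ≠ 0) (h : u ᵥ* A = c • u) : c ∈ spectrum ℂ A := by
  rw [spectrum.mem_iff, ← vecMul_injective_iff_isUnit]
  intro hinj
  refine hu (hinj ?_)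
  simp [vecMul_sub, h, Algebra.algebraMap_eq_smul_one, vecMul_smul]

lemma IsLeftEigenbasis.forall_left_eigenvector_iff {n k l : ℕ} {A : Matrix (Fin n) (Fin n) ℂ}
    {c : ℂ} {X : Matrix (Fin n) (Fin k) ℂ} (hX : IsLeftEigenbasis A c X)
    (B : Matrix (Fin n) (Fin l) ℂ) :
    (∀ u : Fin n → ℂ, u ᵥ* A = c • u → u ᵥ* B = 0 → u = 0) ↔
      ∀ v : Fin k → ℂ, v ᵥ* (Xᵀ * B) = 0 → v = 0 := by
  obtain ⟨hli, heig, hspan⟩ := hX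
  have hsum : ∀ v : Fin k → ℂ, v ᵥ* Xᵀ = ∑ j, v j • matCols X j := fun v => by
    ext i
    simp [vecMul, dotProduct, matCols]
  constructor
  · intro h v hv
    rw [← vecMul_vecMul] at hv
    have h0 := h (v ᵥ* Xᵀ) ?_ hv
    · rw [hsum] at h0
      ext j
      exact Fintype.linearIndependent_iff.1 hli v h0 j
    · rw [hsum, sum_vecMul, Finset.smul_sum]
      refine Finset.sum_congr rfl fun j _ => ?_
      rw [smul_vecMul, ← mulVec_transpose, heig, smul_comm]
  · intro h u hA hB
    obtain ⟨v, rfl⟩ := (Submodule.mem_span_range_iff_exists_fun ℂ).1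
      (hspan u (by rw [mulVec_transpose, hA]))
    rw [← hsum, vecMul_vecMul] at hB
    rw [h v hB]
    simp

/-- Controllability in terms of the left eigenbases. -/
lemma controllable_iff_forall_eigenbasis {n l p : ℕ} {A : Matrix (Fin n) (Fin n) ℝ}
    {μ : Fin p → ℂ} (hspec : spectrum ℂ (A.map Complex.ofReal) = Set.range μ)
    {k : Fin p → ℕ} {X : ∀ i, Matrix (Fin n) (Fin (k i)) ℂ}
    (hX : ∀ i, IsLeftEigenbasis (A.map Complex.ofReal) (μ i) (X i))
    (B : Matrix (Fin n) (Fin l) ℝ) :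
    Controllable A B ↔
      ∀ i, ∀ v : Fin (k i) → ℂ, v ᵥ* ((X i)ᵀ * B.map Complex.ofReal) = 0 → v = 0 := by
  rw [controllable_iff_forall_left_eigenvector]
  simp_rw [← (hX _).forall_left_eigenvector_iff]
  refine ⟨fun h i => h (μ i), fun h c u hA hB => ?_⟩
  by_contra hu
  obtain ⟨i, rfl⟩ := hspec ▸ mem_spectrum_of_vecMul_eq_smul hu hA
  exact hu (h i u hA hB)

lemma image_mem_Hset_iff {n k : ℕ} (X : Matrix (Fin n) (Fin k) ℂ) {e : Fin k → Fin n}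
    (he : Function.Injective e) :
    Finset.image e Finset.univ ∈ Hset X ↔ (X.submatrix e id).det ≠ 0 := by
  have hcard : (Finset.image e Finset.univ).card = k := by
    rw [Finset.card_image_of_injective _ he, Finset.card_fin]
  let E : Fin k ≃ {x // x ∈ Finset.image e Finset.univ} :=
    (Equiv.ofInjective e he).trans (Equiv.subtypeEquivRight fun x => by simp)
  have hrank : (colSub Xᵀ (Finset.image e Finset.univ)).rank = (X.submatrix e id).rank := by
    rw [← rank_submatrix _ (Equiv.refl _) E, ← rank_transpose]
    rfl
  have hvec := rank_eq_card_iff_vecMul (X.submatrix e id)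
  rw [Fintype.card_fin] at hvec
  simp only [Hset, Set.mem_ofPred_eq, hcard, true_and, hrank]
  refine ⟨fun h => ?_, fun h => by rw [rank_of_det_ne_zero h, Fintype.card_fin]⟩
  rw [← isUnit_iff_ne_zero, ← isUnit_iff_isUnit_det, ← vecMul_injective_iff_isUnit,
    ← coe_vecMulLinear, injective_iff_map_eq_zero]
  exact hvec.1 h

/-- Placing `C` at rows `e` and columns `f` of an otherwise zero matrix. -/
lemma exists_extend_submatrix {n l k : ℕ} {e : Fin k → Fin n} {f : Fin k → Fin l}
    (hf : Function.Injective f) (C : Matrix (Fin k) (Fin k) ℝ) (Bpat : Set (Fin n × Fin l))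
    (hC : ∀ s t, (e s, f t) ∉ Bpat → C s t = 0) :
    ∃ B : Matrix (Fin n) (Fin l) ℝ, (∀ j c, (j, c) ∉ Bpat → B j c = 0) ∧
      B.submatrix id f = (1 : Matrix (Fin n) (Fin n) ℝ).submatrix id e * C := by
  refine ⟨(1 : Matrix (Fin n) (Fin n) ℝ).submatrix id e * C *
    (1 : Matrix (Fin l) (Fin l) ℝ).submatrix f id, fun j c hjc => ?_, ?_⟩
  · simp only [mul_apply, submatrix_apply, id, one_apply, Finset.sum_mul]
    refine Finset.sum_eq_zero fun t _ => Finset.sum_eq_zero fun s _ => ?_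
    by_cases h1 : j = e s
    · by_cases h2 : f t = c
      · rw [hC s t (by rwa [← h1, h2])]
        simp
      · simp [h2]
    · simp [h1]
  · rw [submatrix_mul _ _ _ id _ Function.bijective_id, submatrix_submatrix]
    simp [submatrix_one f hf]

/-- Finitely many determinants `det (M i * N i (y))`, with `N i` depending linearly on real
parameters, that are each nonzero somewhere can be made nonzero simultaneously. -/
lemma exists_forall_det_ne_zero {ι : Type*} [Fintype ι] [DecidableEq ι] {n l : ℕ} {k : ι → ℕ}
    (M : ∀ i, Matrix (Fin (k i)) (Fin n) ℂ) (f : ∀ i, Fin (k i) → Fin l)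
    (B : ι → Matrix (Fin n) (Fin l) ℝ)
    (h : ∀ i, (M i * ((B i).map Complex.ofReal).submatrix id (f i)).det ≠ 0) :
    ∃ y : ι → ℝ, ∀ i,
      (M i * ((∑ m, y m • B m).map Complex.ofReal).submatrix id (f i)).det ≠ 0 := by
  let M' : ∀ i, Matrix (Fin (k i)) (Fin n) (MvPolynomial ι ℂ) := fun i =>
    (M i).map MvPolynomial.C
  let N : ∀ i, Matrix (Fin n) (Fin (k i)) (MvPolynomial ι ℂ) := fun i =>
    Matrix.of fun a t => ∑ m, MvPolynomial.X m * MvPolynomial.C (B m a (f i t) : ℂ)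
  let P : ι → MvPolynomial ι ℂ := fun i => det (M' i * N i)
  have heval : ∀ (y : ι → ℝ) i, MvPolynomial.eval (fun m => (y m : ℂ)) (P i) =
      (M i * ((∑ m, y m • B m).map Complex.ofReal).submatrix id (f i)).det := fun y i => by
    refine (RingHom.map_det _ _).trans (congrArg det ?_)
    rw [RingHom.mapMatrix_apply, Matrix.map_mul]
    congr 1
    · ext a t
      simp [M']
    · ext a t
      simp [N, Matrix.sum_apply]
  have hP : ∀ i, P i ≠ 0 := fun i h0 => by
    have h1 := heval (Pi.single i 1) i
    rw [h0, map_zero] at h1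
    refine h i ?_
    rw [h1]
    simp [Pi.single_apply, ite_smul]
  have hprod : ∏ i, P i ≠ 0 := Finset.prod_ne_zero_iff.2 fun i _ => hP i
  by_contra! hcon
  refine hprod (MvPolynomial.funext_set (fun _ => Set.range Complex.ofReal)
    (fun _ => Set.infinite_range_of_injective Complex.ofReal_injective) fun x hx => ?_)
  choose y hy using fun m => hx m (Set.mem_univ m)
  obtain rfl : (fun m => (y m : ℂ)) = x := funext hy
  obtain ⟨i, hi⟩ := hcon y
  rw [map_prod, map_zero]
  exact Finset.prod_eq_zero (Finset.mem_univ i) ((heval y i).trans hi)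


theorem statement_2 {n l p : ℕ} (A : Matrix (Fin n) (Fin n) ℝ)
    (μ : Fin p → ℂ) (hμ : Function.Injective μ)
    (hspec : spectrum ℂ (A.map Complex.ofReal) = Set.range μ)
    (k : Fin p → ℕ) (X : ∀ i, Matrix (Fin n) (Fin (k i)) ℂ)
    (hX : ∀ i, IsLeftEigenbasis (A.map Complex.ofReal) (μ i) (X i))
    (Bpat : Set (Fin n × Fin l)) :
    (∃ B : Matrix (Fin n) (Fin l) ℝ,
        (∀ j c, (j, c) ∉ Bpat → B j c = 0) ∧ Controllable A B) ↔
      ∀ i, ∃ (e : Fin (k i) → Fin n) (f : Fin (k i) → Fin l),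
        Function.Injective e ∧ Function.Injective f ∧
        Finset.image e Finset.univ ∈ Hset (X i) ∧
        ∃ C : Matrix (Fin (k i)) (Fin (k i)) ℝ, C.det ≠ 0 ∧
          ∀ s t, (e s, f t) ∉ Bpat → C s t = 0 := by
  rw [exists_congr fun B => and_congr_right' (controllable_iff_forall_eigenbasis hspec hX B)]
  constructor
  · rintro ⟨B, hB, hker⟩ i
    obtain ⟨f, hf, hdet⟩ := exists_det_submatrix_ne_zero _ (hker i)
    rw [submatrix_mul _ _ _ id _ Function.bijective_id, submatrix_id_id, ← det_transpose,
      transpose_mul, transpose_transpose] at hdet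
    obtain ⟨e, he, hXe⟩ := exists_ne_zero_of_det_mul_ne_zero _ _ hdet
    have he_inj := injective_of_det_submatrix_ne_zero hXe
    refine ⟨e, f, he_inj, hf, (image_mem_Hset_iff _ he_inj).2 hXe, 1, by simp,
      fun s t hst => one_apply_ne fun h => he s ?_⟩
    subst h
    simp [hB _ _ hst]
  · intro h
    choose e f he hf hH C hdet hC using h
    choose B hBpat hBsub using fun i => exists_extend_submatrix (hf i) (C i) Bpat (hC i)
    obtain ⟨y, hy⟩ := exists_forall_det_ne_zero (fun i => (X i)ᵀ) f B fun i => by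
      have h1 : ((B i).map Complex.ofReal).submatrix id (f i) =
          (1 : Matrix (Fin n) (Fin n) ℂ).submatrix id (e i) * (C i).map Complex.ofReal := by
        have h2 := congrArg (fun N => N.map Complex.ofRealHom) (hBsub i)
        rw [Matrix.map_mul] at h2
        refine h2.trans (congrArg (· * _) ?_)
        ext a b
        simp [one_apply, apply_ite]
      have h3 : (X i)ᵀ * (1 : Matrix (Fin n) (Fin n) ℂ).submatrix id (e i) =
          ((X i).submatrix (e i) id)ᵀ := by
        ext a b
        simp [mul_apply, one_apply]
      rw [h1, ← Matrix.mul_assoc, h3, det_mul, det_transpose]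
      refine mul_ne_zero ((image_mem_Hset_iff _ (he i)).1 (hH i)) ?_
      have h4 : ((C i).map Complex.ofReal).det = ((C i).det : ℂ) :=
        (Complex.ofRealHom.map_det (C i)).symm
      rw [h4]
      exact Complex.ofReal_ne_zero.2 (hdet i)
    refine ⟨∑ m, y m • B m, fun j c hjc => ?_, fun i v hv => ?_⟩
    · rw [Matrix.sum_apply]
      exact Finset.sum_eq_zero fun m _ => by simp [hBpat m j c hjc]
    · refine eq_zero_of_vecMul_eq_zero (hy i) ?_
      ext t
      exact congrFun hv (f i t)
end
end

section
/- Let A be an n×n real matrix with p distinct (complex) eigenvalues λ_1,…,λ_p, where λ_i has geometric multiplicity k_i and left eigenbasis X_i, let k_max = max_{1≤i≤p} k_i, and let 𝒳_a ⊆ {1,…,n}. If for every i ∈ {1,…,p} there exists h_i ∈ H_i with h_i ⊆ 𝒳_a, then there exists a real n×k_max matrix B, with every nonzero row of B having its index in 𝒳_a, such that (A,B) is controllable. -/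
open Matrix

noncomputable section

/-- A real controllability matrix has full rank as soon as no nonzero complex row vector
annihilates all the blocks `A ^ j * B`. -/
theorem controllable_of_forall_vecMul {n l : ℕ} (A : Matrix (Fin n) (Fin n) ℝ)
    (B : Matrix (Fin n) (Fin l) ℝ)
    (h : ∀ w : Fin n → ℂ, (∀ j < n, w ᵥ* (A.map Complex.ofReal ^ j * B.map Complex.ofReal) = 0) →
      w = 0) : Controllable A B := by
  have hli : LinearIndependent ℝ (ctrbMat A B).row := by
    rw [← Matrix.vecMul_injective_iff]
    refine (injective_iff_map_eq_zero (Matrix.vecMulLinear (ctrbMat A B))).2 fun v hv => ?_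
    have hw : (fun i => (v i : ℂ)) = 0 := by
      refine h _ fun j hj => funext fun c => ?_
      have hc : ∑ i, v i * (A ^ j * B) i c = 0 := congrFun hv (⟨j, hj⟩, c)
      have hmap : A.map Complex.ofReal ^ j * B.map Complex.ofReal
          = (A ^ j * B).map Complex.ofReal := by
        have hA : A.map Complex.ofReal ^ j = (A ^ j).map Complex.ofReal :=
          (map_pow (Complex.ofRealHom.mapMatrix (m := Fin n)) A j).symm
        rw [hA]
        exact (Matrix.map_mul (f := Complex.ofRealHom)).symm
      rw [hmap]
      have hcc := congrArg Complex.ofReal hc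
      push_cast at hcc
      simpa [Matrix.vecMul, dotProduct] using hcc
    exact funext fun i => Complex.ofReal_injective (congrFun hw i)
  simpa [Controllable] using hli.rank_matrix

/-- By Cayley–Hamilton, a row vector annihilating the first `n` blocks `A ^ j * B` annihilates
all of them. -/
theorem vecMul_pow_mul_eq_zero {K : Type*} [Field K] {n l : ℕ} (A : Matrix (Fin n) (Fin n) K)
    (B : Matrix (Fin n) (Fin l) K) (w : Fin n → K) (h : ∀ j < n, w ᵥ* (A ^ j * B) = 0) (j : ℕ) :
    w ᵥ* (A ^ j * B) = 0 := by
  rcases Nat.eq_zero_or_pos n with rfl | hn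
  · simp [Subsingleton.elim w 0]
  have hdeg : (Polynomial.X ^ j %ₘ A.charpoly).natDegree < n := by
    have hne : A.charpoly ≠ 1 := fun h1 => by
      have := A.charpoly_natDegree_eq_dim
      rw [h1] at this
      simp at this
      omega
    simpa [A.charpoly_natDegree_eq_dim] using
      Polynomial.natDegree_modByMonic_lt (Polynomial.X ^ j) A.charpoly_monic hne
  rw [A.pow_eq_aeval_mod_charpoly, Polynomial.aeval_eq_sum_range' hdeg, Matrix.sum_mul,
    Matrix.vecMul_sum]
  refine Finset.sum_eq_zero fun m hm => ?_
  rw [Matrix.smul_mul, Matrix.vecMul_smul, h m (Finset.mem_range.1 hm), smul_zero]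

/-- Popov–Belevitch–Hautus test: if no left eigenvector of `A` annihilates `B`, then no nonzero
row vector annihilates all the blocks `A ^ j * B`. -/
theorem eq_zero_of_forall_left_eigenvector {K : Type*} [Field K] [IsAlgClosed K] {n l : ℕ}
    (A : Matrix (Fin n) (Fin n) K) (B : Matrix (Fin n) (Fin l) K)
    (hPBH : ∀ (ν : K) (w : Fin n → K), Aᵀ *ᵥ w = ν • w → w ᵥ* B = 0 → w = 0)
    (w : Fin n → K) (h : ∀ j < n, w ᵥ* (A ^ j * B) = 0) : w = 0 := by
  let W : Submodule K (Fin n → K) := ⨅ j : ℕ, LinearMap.ker (Matrix.vecMulLinear (A ^ j * B))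
  have hmem : ∀ v, v ∈ W ↔ ∀ j : ℕ, v ᵥ* (A ^ j * B) = 0 := fun v => by
    simp [W, Submodule.mem_iInf]
  have hinv : ∀ v ∈ W, Matrix.toLin' Aᵀ v ∈ W := fun v hv => by
    rw [hmem] at hv ⊢
    intro j
    rw [Matrix.toLin'_apply, Matrix.mulVec_transpose, Matrix.vecMul_vecMul, ← Matrix.mul_assoc,
      ← pow_succ']
    exact hv (j + 1)
  by_contra hw
  have hwW : w ∈ W := (hmem w).2 (vecMul_pow_mul_eq_zero A B w h)
  have : Nontrivial W := ⟨⟨w, hwW⟩, 0, fun h0 => hw (congrArg Subtype.val h0)⟩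
  obtain ⟨ν, hν⟩ := Module.End.exists_eigenvalue ((Matrix.toLin' Aᵀ).restrict hinv)
  obtain ⟨v, hv⟩ := hν.exists_hasEigenvector
  refine hv.2 (Subtype.ext (hPBH ν v ?_ ?_))
  · simpa using congrArg Subtype.val hv.apply_eq_smul
  · simpa using (hmem v).1 v.2 0

/-- The determinant of the first `k` columns of `Yᵀ B`, where `B` is the generic `n × K` matrix
supported on the rows in `S`. -/
def genericMinor {n k K : ℕ} (hk : k ≤ K) (S : Set (Fin n)) (Y : Matrix (Fin n) (Fin k) ℂ) :
    MvPolynomial (Fin n × Fin K) ℂ :=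
  open Classical in
  (Matrix.of fun a b => ∑ j, MvPolynomial.C (Y j a) *
    (if j ∈ S then MvPolynomial.X (j, Fin.castLE hk b) else 0)).det

open Classical in
theorem eval_genericMinor {n k K : ℕ} (hk : k ≤ K) (S : Set (Fin n))
    (Y : Matrix (Fin n) (Fin k) ℂ) (f : Fin n × Fin K → ℂ) :
    MvPolynomial.eval f (genericMinor hk S Y) =
      (Matrix.of fun a b => ∑ j, Y j a * (if j ∈ S then f (j, Fin.castLE hk b) else 0)).det := by
  rw [genericMinor, RingHom.map_det]
  congr 1
  ext a b
  simp only [RingHom.mapMatrix_apply, Matrix.map_apply, Matrix.of_apply, map_sum, map_mul,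
    MvPolynomial.eval_C]
  refine Finset.sum_congr rfl fun j _ => ?_
  split_ifs <;> simp

theorem genericMinor_ne_zero {n k K : ℕ} (hk : k ≤ K) {S : Set (Fin n)}
    {Y : Matrix (Fin n) (Fin k) ℂ} {J : Finset (Fin n)} (hJ : J ∈ Hset Y)
    (hJS : (J : Set (Fin n)) ⊆ S) : genericMinor hk S Y ≠ 0 := by
  classical
  obtain ⟨hcard, hrank⟩ := hJ
  let e : Fin k ≃ {x // x ∈ J} := Fintype.equivOfCardEq (by simp [hcard])
  have hdet : ((colSub Yᵀ J).submatrix id e).det ≠ 0 := by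
    have hr : ((colSub Yᵀ J).submatrix (Equiv.refl _) e).rank = k := by
      rw [Matrix.rank_submatrix, hrank]
    have hli : LinearIndependent ℂ ((colSub Yᵀ J).submatrix id e).row := by
      rw [linearIndependent_iff_card_eq_finrank_span, Set.finrank,
        ← Matrix.rank_eq_finrank_span_row]
      simpa using hr.symm
    exact ((Matrix.isUnit_iff_isUnit_det _).1
      (Matrix.linearIndependent_rows_iff_isUnit.1 hli)).ne_zero
  intro h0
  let f : Fin n × Fin K → ℂ := fun x =>
    if hx : (x.2 : ℕ) < k then if x.1 = e ⟨x.2, hx⟩ then 1 else 0 else 0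
  have hev := eval_genericMinor hk S Y f
  rw [h0, map_zero] at hev
  refine hdet (Eq.trans ?_ hev.symm)
  congr 1
  ext a b
  have hb : (e b : Fin n) ∈ S := hJS (e b).2
  rw [Matrix.of_apply, Finset.sum_eq_single (e b : Fin n)]
  · simp [colSub, f, hb]
  · intro j _ hj
    simp [f, hj]
  · simp

/-- A finite family of nonzero complex polynomials has a common real non-root. -/
theorem exists_real_eval_ne_zero {σ ι : Type*} [Fintype ι]
    (P : ι → MvPolynomial σ ℂ) (hP : ∀ i, P i ≠ 0) :
    ∃ f : σ → ℝ, ∀ i, MvPolynomial.eval (fun x => (f x : ℂ)) (P i) ≠ 0 := by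
  by_contra! hcon
  refine Finset.prod_ne_zero_iff.2 (fun i _ => hP i) (?_ : ∏ i, P i = 0)
  refine MvPolynomial.funext_set (fun _ => Set.range Complex.ofReal)
    (fun _ => Set.infinite_range_of_injective Complex.ofReal_injective) fun x hx => ?_
  choose f hf using fun s => hx s (Set.mem_univ s)
  obtain ⟨i, hi⟩ := hcon f
  have hfx : (fun s => (f s : ℂ)) = x := funext hf
  rw [hfx] at hi
  rw [map_prod, map_zero, Finset.prod_eq_zero (Finset.mem_univ i) hi]

/-- If the generic minor does not vanish at `B`, then no nonzero combination of the columns of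
`Y` annihilates the matrix obtained from `B` by keeping the rows in `S`. -/
theorem eq_zero_of_mem_span_of_vecMul_eq_zero {n k K : ℕ} (hk : k ≤ K) {S : Set (Fin n)}
    {Y : Matrix (Fin n) (Fin k) ℂ} {f : Fin n × Fin K → ℂ}
    (hf : MvPolynomial.eval f (genericMinor hk S Y) ≠ 0)
    {B : Matrix (Fin n) (Fin K) ℂ}
    (hBS : ∀ j ∈ S, ∀ c, B j c = f (j, c)) (hBS' : ∀ j ∉ S, ∀ c, B j c = 0)
    {w : Fin n → ℂ} (hw : w ∈ Submodule.span ℂ (Set.range (matCols Y))) (hwB : w ᵥ* B = 0) :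
    w = 0 := by
  classical
  obtain ⟨c, rfl⟩ := (Submodule.mem_span_range_iff_exists_fun ℂ).1 hw
  have hcw : ∑ i, c i • matCols Y i = c ᵥ* Yᵀ := by
    ext j
    simp [matCols, Matrix.vecMul, dotProduct]
  rw [hcw] at hwB ⊢
  rw [eval_genericMinor] at hf
  have hc : c = 0 := by
    refine Matrix.eq_zero_of_vecMul_eq_zero hf (funext fun b => ?_)
    rw [Matrix.vecMul_vecMul] at hwB
    refine Eq.trans ?_ (congrFun hwB (Fin.castLE hk b))
    simp only [Matrix.vecMul, dotProduct, Matrix.of_apply, Matrix.mul_apply, Matrix.transpose_apply]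
    refine Finset.sum_congr rfl fun a _ => congrArg (c a * ·) ?_
    refine Finset.sum_congr rfl fun j _ => congrArg (Y j a * ·) ?_
    by_cases hj : j ∈ S
    · simp [hj, hBS]
    · simp [hj, hBS']
  simp [hc]

theorem statement_7 {n p : ℕ} (A : Matrix (Fin n) (Fin n) ℝ)
    (μ : Fin p → ℂ) (hμ : Function.Injective μ)
    (hspec : spectrum ℂ (A.map Complex.ofReal) = Set.range μ)
    (k : Fin p → ℕ) (X : ∀ i, Matrix (Fin n) (Fin (k i)) ℂ)
    (hX : ∀ i, IsLeftEigenbasis (A.map Complex.ofReal) (μ i) (X i))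
    (Xa : Set (Fin n))
    (hfeas : ∀ i, ∃ h ∈ Hset (X i), (↑h : Set (Fin n)) ⊆ Xa) :
    ∃ B : Matrix (Fin n) (Fin (Finset.univ.sup k)) ℝ,
      (∀ j, (∃ c, B j c ≠ 0) → j ∈ Xa) ∧ Controllable A B := by
  classical
  have hk : ∀ i, k i ≤ Finset.univ.sup k := fun i => Finset.le_sup (Finset.mem_univ i)
  obtain ⟨f, hf⟩ := exists_real_eval_ne_zero (fun i => genericMinor (hk i) Xa (X i)) fun i => by
    obtain ⟨J, hJ, hJS⟩ := hfeas i
    exact genericMinor_ne_zero (hk i) hJ hJS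
  refine ⟨Matrix.of fun j c => if j ∈ Xa then f (j, c) else 0, ?_, ?_⟩
  · rintro j ⟨c, hc⟩
    by_contra hj
    simp [hj] at hc
  refine controllable_of_forall_vecMul _ _ (eq_zero_of_forall_left_eigenvector _ _ ?_)
  intro ν w hw hwB
  by_contra hw0
  have hν : ν ∈ spectrum ℂ (A.map Complex.ofReal) := by
    rw [Matrix.mem_spectrum_iff_isRoot_charpoly, ← Matrix.charpoly_transpose,
      ← Matrix.mem_spectrum_iff_isRoot_charpoly, ← Matrix.spectrum_toLin']
    exact (Module.End.hasEigenvalue_of_hasEigenvector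
      (Module.End.hasEigenvector_iff.2 ⟨Module.End.mem_eigenspace_iff.2 hw, hw0⟩)).mem_spectrum
  rw [hspec] at hν
  obtain ⟨i, rfl⟩ := hν
  refine hw0 (eq_zero_of_mem_span_of_vecMul_eq_zero (hk i) (hf i) ?_ ?_ ((hX i).2.2 w hw) hwB)
  · intro j hj c
    simp [hj]
  · intro j hj c
    simp [hj]
end
end
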